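/- For the complete graph K_n with one edge removed (n ≥ 3), which is connected, Kemeny's constant equals 1 + (n-1)/(n+1) + (n-1)(n-3)/n. -/

import Mathlib

open Matrix Finset

/-- If `M` is the group inverse of a Hermitian matrix `N`, then its trace is the sum of the
reciprocals of the nonzero eigenvalues of `N`. -/
theorem Matrix.IsHermitian.sum_inv_eigenvalues_eq_trace {ι : Type*} [Fintype ι] [DecidableEq ι]
    {N M : Matrix ι ι ℝ} (hN : N.IsHermitian) (hcomm : N * M = M * N)
    (hNMN : N * M * N = N) (hMNM : M * N * M = M) :
    ∑ i, (hN.eigenvalues i)⁻¹ = M.trace := by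
  have hvec : ∀ i, M *ᵥ (hN.eigenvectorBasis i).ofLp
      = (hN.eigenvalues i)⁻¹ • (hN.eigenvectorBasis i).ofLp := by
    intro i
    have hv := hN.mulVec_eigenvectorBasis i
    set v : ι → ℝ := (hN.eigenvectorBasis i).ofLp
    set μ := hN.eigenvalues i
    by_cases hμ : μ = 0
    · rw [← hMNM, Matrix.mul_assoc, hcomm, ← Matrix.mulVec_mulVec, ← Matrix.mulVec_mulVec, hv, hμ]
      simp
    · have h : μ • μ • (M *ᵥ v) = μ • v := by
        calc μ • μ • (M *ᵥ v) = (M * N * N) *ᵥ v := by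
              simp only [← Matrix.mulVec_mulVec, hv, Matrix.mulVec_smul]
          _ = μ • v := by rw [← hcomm, hNMN, hv]
      have h' := congrArg (fun w => μ⁻¹ • μ⁻¹ • w) h
      simpa [smul_smul, hμ] using h'
  set U : Matrix ι ι ℝ := (hN.eigenvectorUnitary : Matrix ι ι ℝ)
  have hMU : M * U = U * Matrix.diagonal (fun i => (hN.eigenvalues i)⁻¹) := by
    ext j i
    have h := congrFun (hvec i) j
    rw [Matrix.mul_diagonal, mul_comm]
    exact h
  have hUU : U * star U = 1 := Unitary.coe_mul_star_self hN.eigenvectorUnitary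
  have hUU' : star U * U = 1 := Unitary.coe_star_mul_self hN.eigenvectorUnitary
  rw [← Matrix.mul_one M, ← hUU, ← Matrix.mul_assoc, hMU, Matrix.trace_mul_comm,
    ← Matrix.mul_assoc, hUU', Matrix.one_mul, Matrix.trace_diagonal]

/-- Group inverses of normalized Laplacians: if `G` is symmetric, `(D - A) G = 1 - D J / vol` and
`1ᵀ D G = 0`, then `D^{1/2} G D^{1/2}` is the group inverse of `1 - D^{-1/2} A D^{-1/2}`, so the
sum of the reciprocals of the nonzero eigenvalues of the latter is `∑ i, k i * G i i`. -/
theorem sum_inv_eigenvalues_normalizedLaplacian {ι : Type*} [Fintype ι] [DecidableEq ι]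
    {A G N : Matrix ι ι ℝ} {k : ι → ℝ} {vol : ℝ} (hpos : ∀ i, 0 < k i)
    (hdeg : ∀ i, k i = ∑ j, A i j)
    (hNdef : N = 1 - Matrix.of (fun i j => A i j / (Real.sqrt (k i) * Real.sqrt (k j))))
    (hN : N.IsHermitian) (hG : ∀ i j, G i j = G j i)
    (hLG : ∀ i l, k i * G i l - ∑ j, A i j * G j l = (if i = l then 1 else 0) - k i / vol)
    (hkG : ∀ l, ∑ j, k j * G j l = 0) :
    ∑ i, (hN.eigenvalues i)⁻¹ = ∑ i, k i * G i i := by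
  set s : ι → ℝ := fun i => Real.sqrt (k i) with hs
  have hs0 : ∀ i, s i ≠ 0 := fun i => (Real.sqrt_pos.2 (hpos i)).ne'
  have hss : ∀ i, s i * s i = k i := fun i => Real.mul_self_sqrt (hpos i).le
  set M : Matrix ι ι ℝ := Matrix.of fun i j => s i * G i j * s j with hM
  set Z : Matrix ι ι ℝ := Matrix.of fun i j => s i * s j / vol with hZ
  have hMt : Mᵀ = M := by
    ext i j
    simp only [hM, Matrix.transpose_apply, Matrix.of_apply, hG j i]
    ring
  have hZt : Zᵀ = Z := by
    ext i j
    simp only [hZ, Matrix.transpose_apply, Matrix.of_apply, mul_comm]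
  have hNt : Nᵀ = N := by simpa [Matrix.IsSymm] using hN
  have hNM : N * M = 1 - Z := by
    ext i l
    have hsum : (Matrix.of (fun i j => A i j / (s i * s j)) * M) i l
        = (s i)⁻¹ * s l * ∑ j, A i j * G j l := by
      rw [Matrix.mul_apply, Finset.mul_sum]
      refine Finset.sum_congr rfl fun j _ => ?_
      simp only [hM, Matrix.of_apply]
      have := hs0 i
      have := hs0 j
      field_simp
    have h := hLG i l
    rw [hNdef, Matrix.sub_mul, Matrix.one_mul, Matrix.sub_apply, hsum, Matrix.sub_apply,
      Matrix.one_apply]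
    simp only [hM, hZ, Matrix.of_apply]
    have hi := hs0 i
    have h2 : ∑ j, A i j * G j l
        = s i * s i * G i l - ((if i = l then 1 else 0) - s i * s i / vol) := by
      rw [hss]
      linarith
    rw [h2]
    split_ifs with hil
    · subst hil
      field_simp
      ring
    · field_simp
      ring
  have hMN : M * N = 1 - Z := by
    have := congrArg Matrix.transpose hNM
    simpa [Matrix.transpose_mul, hMt, hNt, hZt] using this
  have hZM : Z * M = 0 := by
    ext i l
    have h : (Z * M) i l = s i / vol * s l * ∑ j, k j * G j l := by
      rw [Matrix.mul_apply, Finset.mul_sum]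
      refine Finset.sum_congr rfl fun j _ => ?_
      simp only [hM, hZ, Matrix.of_apply, ← hss j]
      ring
    rw [h, hkG]
    simp
  have hNZ : N * Z = 0 := by
    ext i l
    have hsum : (Matrix.of (fun i j => A i j / (s i * s j)) * Z) i l
        = (s i)⁻¹ * s l / vol * ∑ j, A i j := by
      rw [Matrix.mul_apply, Finset.mul_sum]
      refine Finset.sum_congr rfl fun j _ => ?_
      simp only [hZ, Matrix.of_apply]
      have := hs0 i
      have := hs0 j
      field_simp
    rw [hNdef, Matrix.sub_mul, Matrix.one_mul, Matrix.sub_apply, hsum, ← hdeg, ← hss]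
    simp only [hZ, Matrix.of_apply]
    have := hs0 i
    field_simp
    simp
  rw [hN.sum_inv_eigenvalues_eq_trace (hNM.trans hMN.symm)
    (by rw [Matrix.mul_assoc, hMN, Matrix.mul_sub, hNZ, Matrix.mul_one, sub_zero])
    (by rw [hMN, Matrix.sub_mul, hZM, Matrix.one_mul, sub_zero])]
  refine Finset.sum_congr rfl fun i _ => ?_
  simp only [hM, Matrix.diag_apply, Matrix.of_apply, ← hss i]
  ring

set_option maxHeartbeats 1000000 in
/-- Kemeny's constant of the complete graph `K_n` with one edge removed (`n ≥ 3`),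
which is connected, equals `1 + (n-1)/(n+1) + (n-1)(n-3)/n`. Kemeny's constant is the
sum of reciprocals of the nonzero eigenvalues of the normalized Laplacian
`N = I - D^{-1/2} A D^{-1/2}` (since `(0:ℝ)⁻¹ = 0`, summing `(μ i)⁻¹` over all `i`
gives exactly the sum over the nonzero eigenvalues). -/
theorem kemeny_complete_minus_edge (n : ℕ) (hn : 3 ≤ n)
    (e0 e1 : Fin n) (he0 : e0 = ⟨0, by omega⟩) (he1 : e1 = ⟨1, by omega⟩)
    (A : Matrix (Fin n) (Fin n) ℝ)
    (hA : ∀ i j, A i j =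
      if i = j ∨ (i = e0 ∧ j = e1) ∨ (i = e1 ∧ j = e0) then 0 else 1)
    (k : Fin n → ℝ) (hk : ∀ i, k i = ∑ j, A i j)
    (N : Matrix (Fin n) (Fin n) ℝ)
    (hNdef : N = 1 - Matrix.of (fun i j => A i j / (Real.sqrt (k i) * Real.sqrt (k j))))
    (hN : N.IsHermitian) :
    ∑ i, (hN.eigenvalues i)⁻¹
      = 1 + ((n : ℝ) - 1)/((n : ℝ) + 1) + ((n : ℝ) - 1) * ((n : ℝ) - 3) / n := by
  have hn' : (3 : ℝ) ≤ n := by exact_mod_cast hn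
  have hne : e0 ≠ e1 := by simp [he0, he1]
  clear he0 he1
  set m : ℝ := (n : ℝ) with hm
  have m0 : m ≠ 0 := by linarith
  have m1 : m - 1 ≠ 0 := by linarith
  have m2 : m - 2 ≠ 0 := by linarith
  have m3 : m + 1 ≠ 0 := by linarith
  set e : Fin n → ℝ := fun i => if i = e0 then 1 else 0 with he
  set f : Fin n → ℝ := fun i => if i = e1 then 1 else 0 with hf
  have hsum_e : ∀ g : Fin n → ℝ, ∑ j, e j * g j = g e0 := by simp [he]
  have hsum_f : ∀ g : Fin n → ℝ, ∑ j, f j * g j = g e1 := by simp [hf]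
  have hAe : ∀ i j, A i j = 1 - (if i = j then 1 else 0) - e i * f j - f i * e j := by
    intro i j
    rw [hA]
    simp only [he, hf]
    by_cases h0 : i = e0 <;> by_cases h1 : i = e1 <;> by_cases h2 : j = e0 <;>
      by_cases h3 : j = e1 <;> by_cases h4 : i = j <;> simp_all
  have hAsum : ∀ (i : Fin n) (g : Fin n → ℝ),
      ∑ j, A i j * g j = ∑ j, g j - g i - e i * g e1 - f i * g e0 := by
    intro i g
    simp only [hAe, sub_mul, Finset.sum_sub_distrib, one_mul, mul_assoc, ← Finset.mul_sum,
      hsum_e, hsum_f]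
    simp
  have hke : ∀ i, k i = m - 1 - e i - f i := by
    intro i
    have := hAsum i (fun _ => 1)
    simp only [mul_one, ← hk] at this
    simpa using this
  have hcases : ∀ i, (i = e0 ∧ e i = 1 ∧ f i = 0) ∨ (i = e1 ∧ e i = 0 ∧ f i = 1) ∨
      (i ≠ e0 ∧ i ≠ e1 ∧ e i = 0 ∧ f i = 0) := by
    intro i
    by_cases h0 : i = e0 <;> by_cases h1 : i = e1 <;> simp [he, hf, h0, h1, hne, hne.symm]
  have hite0 : ∀ l (c : ℝ), (if e0 = l then c else 0) = e l * c := by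
    intro l c
    simp [he, eq_comm]
  have hite1 : ∀ l (c : ℝ), (if e1 = l then c else 0) = f l * c := by
    intro l c
    simp [hf, eq_comm]
  have hse : ∑ j, e j = 1 := by simp [he]
  have hsf : ∑ j, f j = 1 := by simp [hf]
  have hee0 : e e0 = 1 := by simp [he]
  have hee1 : e e1 = 0 := by simp [he, hne.symm]
  have hfe0 : f e0 = 0 := by simp [hf, hne]
  have hfe1 : f e1 = 1 := by simp [hf]
  have hpos : ∀ i, 0 < k i := by
    intro i
    rw [hke]
    rcases hcases i with ⟨-, h, h'⟩ | ⟨-, h, h'⟩ | ⟨-, -, h, h'⟩ <;> rw [h, h'] <;> linarith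
  set y : Fin n → ℝ := fun i => (m + 1) * (e i + f i) - 2 with hy
  have hsy : ∑ j, y j = 2 := by
    simp only [hy, Finset.sum_sub_distrib, ← Finset.mul_sum, Finset.sum_add_distrib, hse, hsf]
    simp
    ring
  set G : Matrix (Fin n) (Fin n) ℝ := Matrix.of fun i j =>
    (if i = j then (m - 1) / m / (m - 1 - e j - f j) else 0) - (m - 1) / m / ((m - 2) * (m + 1))
      + (e i - f i) * ((e j - f j) / (2 * m * (m - 2)))
      - y i * (y j / (2 * m * (m + 1) ^ 2 * (m - 2))) with hGdef
  have hGsum : ∀ l, ∑ j, G j l = (m - 1) / m / (m - 1 - e l - f l)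
      - (m - 1) / ((m - 2) * (m + 1)) - y l / (m * (m + 1) ^ 2 * (m - 2)) := by
    intro l
    simp only [hGdef, Matrix.of_apply, Finset.sum_sub_distrib, Finset.sum_add_distrib,
      ← Finset.sum_mul, hsy, hse, hsf]
    simp only [Finset.sum_ite_eq', Finset.mem_univ, if_true, Finset.sum_const, Finset.card_univ,
      Fintype.card_fin, nsmul_eq_mul, ← hm]
    field_simp
    ring
  have m2' : m - 1 - 1 ≠ 0 := by linarith
  rw [sum_inv_eigenvalues_normalizedLaplacian (G := G) (vol := (m - 2) * (m + 1)) hpos hk hNdef hN]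
  · have hdiag : ∀ i, k i * G i i = (m - 1) / m - (m - 1) ^ 2 / m / ((m - 2) * (m + 1))
        - 2 * (m - 1) / (m * (m + 1) ^ 2 * (m - 2))
        + (e i + f i) * (1 / (2 * m) - (m - 1) ^ 2 / (2 * m * (m + 1) ^ 2)
          + (m - 1) / m / ((m - 2) * (m + 1)) + 2 * (m - 1) / (m * (m + 1) ^ 2 * (m - 2))) := by
      intro i
      simp only [hke, hGdef, Matrix.of_apply, if_true, hy]
      rcases hcases i with ⟨-, h, h'⟩ | ⟨-, h, h'⟩ | ⟨-, -, h, h'⟩ <;> rw [h, h']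
      all_goals
        simp only [sub_zero]
        field_simp
        ring
    simp only [hdiag, Finset.sum_add_distrib, ← Finset.sum_mul, hse, hsf]
    simp only [Finset.sum_const, Finset.card_univ, Fintype.card_fin, nsmul_eq_mul, ← hm]
    field_simp
    ring
  · intro i j
    by_cases hij : i = j
    · rw [hij]
    · simp only [hGdef, Matrix.of_apply, hij, Ne.symm hij, if_false]
      ring
  · intro i l
    rw [hAsum i (fun j => G j l), hGsum]
    simp only [hke, hGdef, Matrix.of_apply, hy, hee0, hee1, hfe0, hfe1, hite0, hite1]
    rcases eq_or_ne i l with rfl | hil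
    · rcases hcases i with ⟨-, h1, h2⟩ | ⟨-, h1, h2⟩ | ⟨-, -, h1, h2⟩ <;>
        simp only [h1, h2, if_true, sub_zero] <;> field_simp <;> ring
    · simp only [hil, if_false]
      rcases hcases i with ⟨hi, h1, h2⟩ | ⟨hi, h1, h2⟩ | ⟨-, -, h1, h2⟩ <;>
        rcases hcases l with ⟨hl, h3, h4⟩ | ⟨hl, h3, h4⟩ | ⟨-, -, h3, h4⟩ <;>
        first
          | exact absurd (hi.trans hl.symm) hil
          | (simp only [h1, h2, h3, h4, sub_zero]; field_simp; ring)
  · intro l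
    have h : ∑ j, k j * G j l = (m - 1) * ∑ j, G j l - G e0 l - G e1 l := by
      simp only [hke, sub_mul, Finset.sum_sub_distrib, hsum_e (fun j => G j l),
        hsum_f (fun j => G j l), Finset.mul_sum]
    rw [h, hGsum]
    simp only [hGdef, Matrix.of_apply, hy, hee0, hee1, hfe0, hfe1, hite0, hite1]
    rcases hcases l with ⟨-, h3, h4⟩ | ⟨-, h3, h4⟩ | ⟨-, -, h3, h4⟩ <;>
      simp only [h3, h4, sub_zero] <;> field_simp <;> ring
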